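/- Let (X, δ) be a metric-like space, let I be an admissible ideal of subsets of ℕ, and let (x_n) be a sequence in X. If (x_n) is I-convergent to x₀ ∈ X, then there exists a strictly increasing sequence (n_k) of natural numbers such that the subsequence (x_{n_k}) converges to x₀ in the usual sense, i.e. lim_{k→∞} δ(x_{n_k}, x₀) = δ(x₀, x₀). -/

import Mathlib

open Filter Topology

/-- A metric-like space structure on `X`. -/
structure MetricLike (X : Type*) where
  d : X → X → ℝ
  nonneg : ∀ x y, 0 ≤ d x y
  eq_of_eq_zero : ∀ x y, d x y = 0 → x = y
  symm : ∀ x y, d x y = d y x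
  triangle : ∀ x y z, d x y ≤ d x z + d z y

/-- `I` is an ideal of subsets of `ℕ`. -/
def IsIdeal (I : Set (Set ℕ)) : Prop :=
  ∅ ∈ I ∧ (∀ A B : Set ℕ, A ∈ I → B ∈ I → A ∪ B ∈ I) ∧
    (∀ A B : Set ℕ, A ∈ I → B ⊆ A → B ∈ I)

/-- `I` is an admissible ideal of subsets of `ℕ`. -/
def IsAdmissibleIdeal (I : Set (Set ℕ)) : Prop :=
  IsIdeal I ∧ (Set.univ : Set ℕ) ∉ I ∧ ∀ n : ℕ, ({n} : Set ℕ) ∈ I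

/-- Usual convergence of a sequence in a metric-like space. -/
def MLConv {X : Type*} (δ : MetricLike X) (x : ℕ → X) (x₀ : X) : Prop :=
  ∀ ε : ℝ, 0 < ε → ∃ k₀ : ℕ, ∀ n ≥ k₀, |δ.d (x n) x₀ - δ.d x₀ x₀| < ε

/-- `I`-convergence of a sequence in a metric-like space. -/
def MLIConv (I : Set (Set ℕ)) {X : Type*} (δ : MetricLike X) (x : ℕ → X) (x₀ : X) : Prop :=
  ∀ ε : ℝ, 0 < ε → {n : ℕ | ε ≤ |δ.d (x n) x₀ - δ.d x₀ x₀|} ∈ I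

/-- `I*`-convergence of a sequence in a metric-like space: there is a set
`M = {n₁ < n₂ < …}` in the filter `F(I)` (i.e. with complement in `I`) such that
`δ(x_{n_k}, x₀) → δ(x₀, x₀)`. -/
def MLIStarConv (I : Set (Set ℕ)) {X : Type*} (δ : MetricLike X) (x : ℕ → X) (x₀ : X) : Prop :=
  ∃ M : Set ℕ, Mᶜ ∈ I ∧ ∃ nk : ℕ → ℕ, StrictMono nk ∧ Set.range nk = M ∧
    Tendsto (fun k => δ.d (x (nk k)) x₀) atTop (𝓝 (δ.d x₀ x₀))

/-- The open `δ`-ball with centre `c` and radius `ε`. -/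
def MLBall {X : Type*} (δ : MetricLike X) (c : X) (ε : ℝ) : Set X :=
  {x : X | |δ.d x c - δ.d c c| < ε}

/-- The `T₀` separation axiom for a metric-like space. -/
def MLT0 {X : Type*} (δ : MetricLike X) : Prop :=
  ∀ x y : X, x ≠ y → ∃ (c : X) (ε : ℝ), 0 < ε ∧
    ((x ∈ MLBall δ c ε ∧ y ∉ MLBall δ c ε) ∨ (y ∈ MLBall δ c ε ∧ x ∉ MLBall δ c ε))

/-- `x₀` is a limit point of the metric-like space `X`. -/
def MLLimitPoint {X : Type*} (δ : MetricLike X) (x₀ : X) : Prop :=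
  ∀ r : ℝ, 0 < r → (MLBall δ x₀ r ∩ {x₀}ᶜ).Nonempty

/-- `x₀` is an isolated point of the metric-like space `X`. -/
def MLIsolated {X : Type*} (δ : MetricLike X) (x₀ : X) : Prop :=
  ∃ r : ℝ, 0 < r ∧ MLBall δ x₀ r = {x₀}

/-- The condition (AP) for an ideal of subsets of `ℕ`. -/
def HasAP (I : Set (Set ℕ)) : Prop :=
  ∀ A : ℕ → Set ℕ, (∀ j, A j ∈ I) → (∀ i j, i ≠ j → Disjoint (A i) (A j)) →
    ∃ B : ℕ → Set ℕ, (∀ j, (symmDiff (A j) (B j)).Finite) ∧ (⋃ j, B j) ∈ I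

/-- Every initial segment of `ℕ` belongs to an admissible ideal. -/
theorem IsAdmissibleIdeal.Iio_mem {I : Set (Set ℕ)} (hI : IsAdmissibleIdeal I) (N : ℕ) :
    Set.Iio N ∈ I := by
  induction N with
  | zero => simpa using hI.1.1
  | succ N ih =>
    refine hI.1.2.2 _ _ (hI.1.2.1 _ _ ih (hI.2.2 N)) fun n hn => ?_
    simp only [Set.mem_Iio, Set.mem_union, Set.mem_singleton_iff] at hn ⊢
    omega

/-- The complement of a member of an admissible ideal is infinite. -/
theorem IsAdmissibleIdeal.frequently_notMem {I : Set (Set ℕ)} (hI : IsAdmissibleIdeal I)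
    {A : Set ℕ} (hA : A ∈ I) : ∃ᶠ n in atTop, n ∉ A := by
  rw [frequently_atTop]
  intro N
  by_contra! hN
  refine hI.2.1 (hI.1.2.2 _ _ (hI.1.2.1 _ _ (hI.Iio_mem N) hA) fun n _ => ?_)
  exact (lt_or_ge n N).imp id (hN n)

theorem ideal_convergent_imp_exists_convergent_subseq {X : Type*} (δ : MetricLike X)
    (I : Set (Set ℕ)) (hI : IsAdmissibleIdeal I) (x : ℕ → X) (x₀ : X)
    (h : MLIConv I δ x x₀) :
    ∃ nk : ℕ → ℕ, StrictMono nk ∧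
      Tendsto (fun k => δ.d (x (nk k)) x₀) atTop (𝓝 (δ.d x₀ x₀)) := by
  obtain ⟨nk, hmono, hnk⟩ := extraction_forall_of_frequently fun k : ℕ =>
    hI.frequently_notMem (h (1 / ((k : ℝ) + 1)) Nat.one_div_pos_of_nat)
  refine ⟨nk, hmono, tendsto_iff_dist_tendsto_zero.2 ?_⟩
  exact squeeze_zero (fun _ => dist_nonneg) (fun k => (not_le.1 (hnk k)).le)
    tendsto_one_div_add_atTop_nhds_zero_nat
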